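/- arXiv:math/0608274 — 2 statements merged into one kernel-verified Lean document; each statement's English description precedes it below -/
import Mathlib

section
/- For every integer n ≥ 0, the polynomial identity Σ_{m=0}^{n} [n choose m]_q · ((tq)^{n−m} − tq) · A_m^{maj,exc}(q,t) = 1 − tq holds in ℤ[q,t]. (This is the coefficientwise form, obtained by clearing denominators, of the q-exponential generating function formula Σ_{n≥0} A_n^{maj,exc}(q,t) z^n/[n]_q! = (1−tq)·exp_q(z) / (exp_q(ztq) − tq·exp_q(z)).) -/
/-!
STATEMENT 0: For every integer n ≥ 0, the polynomial identity
Σ_{m=0}^{n} [n choose m]_q · ((tq)^{n−m} − tq) · A_m^{maj,exc}(q,t) = 1 − tq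
holds in ℤ[q,t].  We work in the fraction field of ℤ[q,t], where the Gaussian binomial
coefficient can be written directly as [n]_q!/([m]_q![n−m]_q!); since the embedding
ℤ[q,t] → Frac(ℤ[q,t]) is injective this is equivalent to the identity in ℤ[q,t].
-/

noncomputable section

/-- The one-line value `σ(i)` of a permutation of `[n] = {1,…,n}` (1-based), extended
to all of `ℕ` by the identity outside `[n]`. -/
def pv {n : ℕ} (σ : Equiv.Perm (Fin n)) (i : ℕ) : ℕ :=
  if h : 1 ≤ i ∧ i ≤ n then ((σ ⟨i - 1, by omega⟩ : Fin n) : ℕ) + 1 else i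

/-- The descent set `Des(σ) = {i ∈ [n-1] : σ(i) > σ(i+1)}`. -/
def DesSet {n : ℕ} (σ : Equiv.Perm (Fin n)) : Finset ℕ :=
  (Finset.Icc 1 (n - 1)).filter fun i => pv σ (i + 1) < pv σ i

/-- The major index `maj(σ) = Σ_{i ∈ Des(σ)} i`. -/
def maj {n : ℕ} (σ : Equiv.Perm (Fin n)) : ℕ := ∑ i ∈ DesSet σ, i

/-- The excedance set `Exc(σ) = {i ∈ [n-1] : σ(i) > i}`. -/
def ExcSet {n : ℕ} (σ : Equiv.Perm (Fin n)) : Finset ℕ :=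
  (Finset.Icc 1 (n - 1)).filter fun i => i < pv σ i

/-- The excedance number `exc(σ) = |Exc(σ)|`. -/
def exc {n : ℕ} (σ : Equiv.Perm (Fin n)) : ℕ := (ExcSet σ).card

/-- The field of rational functions in two variables `q = X 0`, `t = X 1` over `ℤ`. -/
abbrev K : Type := FractionRing (MvPolynomial (Fin 2) ℤ)

/-- The variable `q` in `Frac(ℤ[q,t])`. -/
def qv : K := algebraMap (MvPolynomial (Fin 2) ℤ) K (MvPolynomial.X 0)

/-- The variable `t` in `Frac(ℤ[q,t])`. -/
def tv : K := algebraMap (MvPolynomial (Fin 2) ℤ) K (MvPolynomial.X 1)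

/-- `[k]_x = 1 + x + ⋯ + x^{k-1}`. -/
def qInt (x : K) (k : ℕ) : K := ∑ i ∈ Finset.range k, x ^ i

/-- `[n]_x! = [n]_x [n-1]_x ⋯ [1]_x`. -/
def qFact (x : K) (n : ℕ) : K := ∏ k ∈ Finset.range n, qInt x (k + 1)

/-- The Gaussian binomial coefficient `[n choose m]_q = [n]_q!/([m]_q! [n-m]_q!)`. -/
def qBinom (n m : ℕ) : K := qFact qv n / (qFact qv m * qFact qv (n - m))

/-- The q-Eulerian polynomial `A_n^{maj,exc}(q,t) = Σ_{σ ∈ S_n} q^{maj σ} t^{exc σ}`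
(for `n = 0` the sum over the one-element group `S_0` is `1`). -/
def qEulerian (n : ℕ) : K := ∑ σ : Equiv.Perm (Fin n), qv ^ maj σ * tv ^ exc σ

open Finset

section Elimination

/-- The product `a * b ^ m` of length `m + 1`, and `1` for length `0`. -/
def headPow {P : Type*} [CommRing P] (a b : P) : ℕ → P
  | 0 => 1
  | m + 1 => a * b ^ m

lemma map_headPow {P Q : Type*} [CommRing P] [CommRing Q] (f : P →+* Q) (a b : P) (m : ℕ) :
    f (headPow a b m) = headPow (f a) (f b) m := by
  cases m <;> simp [headPow]

namespace Polynomial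

variable {P : Type*} [CommRing P] {M : ℕ} {x a u E : P}

lemma sum_diagonal_coeff_X_mul (hx : x ^ M = 0) (φ : P[X]) :
    (1 - a * x) * ∑ m ∈ range M, x ^ m * ((C u + C a * X) ^ m * (X * φ)).coeff m =
      x * u * ∑ m ∈ range M, x ^ m * ((C u + C a * X) ^ m * φ).coeff m := by
  have h1 : ∑ m ∈ range M, x ^ m * ((C u + C a * X) ^ m * (X * φ)).coeff m =
      ∑ m ∈ range M, x ^ (m + 1) * ((C u + C a * X) ^ (m + 1) * (X * φ)).coeff (m + 1) := by
    have h := sum_range_succ' (fun m => x ^ m * ((C u + C a * X) ^ m * (X * φ)).coeff m) M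
    rw [sum_range_succ] at h
    simpa [hx] using h
  have h2 : ∀ m, ((C u + C a * X) ^ (m + 1) * (X * φ)).coeff (m + 1) =
      u * ((C u + C a * X) ^ m * φ).coeff m + a * ((C u + C a * X) ^ m * (X * φ)).coeff m := by
    intro m
    rw [show (C u + C a * X) ^ (m + 1) * (X * φ) =
      (C u * ((C u + C a * X) ^ m * φ) + C a * ((C u + C a * X) ^ m * (X * φ))) * X by ring,
      coeff_mul_X, coeff_add, coeff_C_mul, coeff_C_mul]
  rw [sub_mul, one_mul]
  nth_rewrite 1 [h1]
  rw [sub_eq_iff_eq_add, mul_sum, mul_sum, ← sum_add_distrib]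
  refine sum_congr rfl fun m _ => ?_
  rw [h2]
  ring

/-- The one-variable linear case of Lagrange inversion, for a nilpotent `x`. -/
lemma sum_diagonal_coeff (hx : x ^ M = 0) (hE : E * (1 - a * x) = 1) (φ : P[X]) :
    ∑ m ∈ range M, x ^ m * ((C u + C a * X) ^ m * φ).coeff m = E * φ.eval (E * x * u) := by
  induction φ using Polynomial.induction_on with
  | C r =>
    have h : ∀ m, ((C u + C a * X) ^ m).coeff m = a ^ m := by
      intro m
      have := coeff_pow_of_natDegree_le (p := C u + C a * X) (n := 1) (m := m) (by compute_degree)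
      simpa using this
    have hg : (1 - a * x) * ∑ m ∈ range M, (a * x) ^ m = 1 := by
      rw [mul_neg_geom_sum, mul_pow, hx, mul_zero, sub_zero]
    have hg' : ∑ m ∈ range M, (a * x) ^ m = E := by
      calc _ = E * ((1 - a * x) * ∑ m ∈ range M, (a * x) ^ m) := by
            rw [← mul_assoc, hE, one_mul]
        _ = E := by rw [hg, mul_one]
    simp only [coeff_mul_C, h, eval_C]
    rw [← hg', sum_mul]
    refine sum_congr rfl fun m _ => by ring
  | add p r hp hr => simp only [mul_add, coeff_add, sum_add_distrib, hp, hr, eval_add]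
  | monomial n r ih =>
    have h := sum_diagonal_coeff_X_mul (a := a) (u := u) hx (C r * X ^ n)
    rw [ih] at h
    have e : C r * X ^ (n + 1) = X * (C r * X ^ n) := by ring
    rw [e]
    rw [eval_mul (p := X), eval_X]
    linear_combination E * h - (∑ m ∈ range M,
      x ^ m * ((C u + C a * X) ^ m * (X * (C r * X ^ n))).coeff m) * hE

lemma sum_diagonal_coeff_headPow (hx : x ^ M = 0) (hE : E * (1 - a * x) = 1) (t : P) (φ : P[X]) :
    ∑ m ∈ range M, x ^ m *
        (headPow (C u + C a * X - C t * X) (C u + C a * X) m * φ).coeff m =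
      (1 - t * x) * E * φ.eval (E * x * u) := by
  rw [mul_assoc, ← sum_diagonal_coeff hx hE]
  obtain _ | M := M
  · simp
  have hs := sum_range_succ (fun m => x ^ m * ((C u + C a * X) ^ m * φ).coeff m) M
  have hlast : t * x * (x ^ M * ((C u + C a * X) ^ M * φ).coeff M) = 0 := by
    linear_combination (t * ((C u + C a * X) ^ M * φ).coeff M) * hx
  rw [sub_mul, one_mul, hs, mul_add, hlast, ← hs, sum_range_succ', sum_range_succ']
  simp only [headPow, add_zero, pow_zero, one_mul]
  rw [eq_sub_iff_add_eq, add_right_comm, mul_sum, ← sum_add_distrib]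
  congr 1
  refine sum_congr rfl fun m _ => ?_
  rw [show (C u + C a * X - C t * X) * (C u + C a * X) ^ m * φ =
    (C u + C a * X) ^ (m + 1) * φ - C t * ((C u + C a * X) ^ m * φ * X) by ring, coeff_sub,
    coeff_C_mul, coeff_mul_X]
  ring

end Polynomial

open MvPolynomial in
/-- The sum over exponent vectors `ν` of `x^ν` times the coefficient of `y^ν` in the product of
the `ν`-th powers of the linear forms given by the rows of `A`, where one factor of each power
has its diagonal entry lowered by `t`. -/
noncomputable def masterSum {S : Type*} [CommRing S] {N : ℕ} (M : ℕ) (t : S) (x : Fin N → S)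
    (A : Fin N → Fin N → S) : S :=
  ∑ ν : Fin N → Fin M, (∏ c, x c ^ (ν c : ℕ)) *
    coeff (Finsupp.equivFunOnFinite.symm fun c => (ν c : ℕ))
      (∏ c, headPow (∑ d, C (A c d) * X d - C t * X c) (∑ d, C (A c d) * X d) (ν c))

open MvPolynomial in
lemma masterSum_succ {S : Type*} [CommRing S] {N M : ℕ} (t : S) (x : Fin (N + 1) → S)
    (A : Fin (N + 1) → Fin (N + 1) → S) (hx : x 0 ^ M = 0) {E : S}
    (hE : E * (1 - A 0 0 * x 0) = 1) :
    masterSum M t x A = (1 - t * x 0) * E * masterSum M t (fun c => x c.succ)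
      (fun c d => A c.succ d.succ + A c.succ 0 * (E * x 0) * A 0 d.succ) := by
  unfold masterSum
  rw [← (Fin.consEquiv fun _ => Fin M).sum_comp, Fintype.sum_prod_type_right, mul_sum]
  refine sum_congr rfl fun ν _ => ?_
  simp only [Fin.consEquiv_apply, Fin.prod_univ_succ, Fin.cons_zero, Fin.cons_succ]
  set u : MvPolynomial (Fin N) S := ∑ d : Fin N, C (A 0 d.succ) * X d with hu
  set Φ : Polynomial (MvPolynomial (Fin N) S) := ∏ c : Fin N,
    headPow (Polynomial.C (∑ d : Fin N, C (A c.succ d.succ) * X d) +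
        Polynomial.C (C (A c.succ 0)) * Polynomial.X - Polynomial.C (C t * X c))
      (Polynomial.C (∑ d : Fin N, C (A c.succ d.succ) * X d) +
        Polynomial.C (C (A c.succ 0)) * Polynomial.X) (ν c) with hΦ
  have key := Polynomial.sum_diagonal_coeff_headPow (P := MvPolynomial (Fin N) S) (M := M)
    (x := C (x 0)) (a := C (A 0 0)) (u := u) (E := C E) (by rw [← map_pow, hx, map_zero])
    (by rw [← map_mul, ← map_one C, ← map_sub, ← map_mul, hE]) (C t) Φ
  have hev : Φ.eval (C E * C (x 0) * u) = ∏ c : Fin N,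
      headPow (∑ d, C (A c.succ d.succ + A c.succ 0 * (E * x 0) * A 0 d.succ) * X d - C t * X c)
        (∑ d, C (A c.succ d.succ + A c.succ 0 * (E * x 0) * A 0 d.succ) * X d) (ν c) := by
    have h2 : ∀ c : Fin N, (∑ d, C (A c.succ d.succ + A c.succ 0 * (E * x 0) * A 0 d.succ) * X d :
        MvPolynomial (Fin N) S) =
        ∑ d : Fin N, C (A c.succ d.succ) * X d + C (A c.succ 0) * (C E * C (x 0) * u) := by
      intro c
      rw [hu, mul_sum, mul_sum, ← sum_add_distrib]
      refine sum_congr rfl fun d _ => ?_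
      simp only [map_add, map_mul]
      ring
    rw [hΦ, Polynomial.eval_prod]
    refine prod_congr rfl fun c _ => ?_
    rw [← Polynomial.coe_evalRingHom, map_headPow, h2]
    simp only [Polynomial.coe_evalRingHom, Polynomial.eval_sub, Polynomial.eval_add,
      Polynomial.eval_mul, Polynomial.eval_C, Polynomial.eval_X]
  rw [hev] at key
  have hcoef : ∀ m : Fin M, coeff (Finsupp.equivFunOnFinite.symm
        fun c => ((Fin.cons m ν : Fin (N + 1) → Fin M) c : ℕ))
      (headPow (∑ d, C (A 0 d) * X d - C t * X 0) (∑ d, C (A 0 d) * X d) m *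
        ∏ c : Fin N, headPow (∑ d, C (A c.succ d) * X d - C t * X c.succ)
          (∑ d, C (A c.succ d) * X d) (ν c)) =
      coeff (Finsupp.equivFunOnFinite.symm fun c => (ν c : ℕ))
        ((headPow (Polynomial.C u + Polynomial.C (C (A 0 0)) * Polynomial.X -
            Polynomial.C (C t) * Polynomial.X)
          (Polynomial.C u + Polynomial.C (C (A 0 0)) * Polynomial.X) m * Φ).coeff m) := by
    intro m
    have h1 : (Finsupp.equivFunOnFinite.symm
        fun c => ((Fin.cons m ν : Fin (N + 1) → Fin M) c : ℕ)) =
        (Finsupp.equivFunOnFinite.symm fun c => (ν c : ℕ)).cons (m : ℕ) := by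
      ext c
      refine Fin.cases ?_ (fun c => ?_) c <;> simp
    rw [h1, ← finSuccEquiv_coeff_coeff, map_mul, map_prod]
    have h3 : ∀ p : S, (finSuccEquiv S N) (C p) = Polynomial.C (C p) := fun p => by
      rw [finSuccEquiv_apply, eval₂Hom_C]; rfl
    have h4 : ∀ p : Fin (N + 1), (finSuccEquiv S N) (∑ d, C (A p d) * X d) =
        Polynomial.C (∑ d : Fin N, C (A p d.succ) * X d) +
          Polynomial.C (C (A p 0)) * Polynomial.X := by
      intro p
      rw [Fin.sum_univ_succ]
      simp only [map_add, map_mul, map_sum, h3, finSuccEquiv_X_zero, finSuccEquiv_X_succ]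
      rw [add_comm]
    have h5 : ∀ (a b : MvPolynomial (Fin (N + 1)) S) (k : ℕ), finSuccEquiv S N (headPow a b k) =
        headPow (finSuccEquiv S N a) (finSuccEquiv S N b) k :=
      fun a b k => map_headPow (finSuccEquiv S N).toRingEquiv.toRingHom a b k
    simp only [h5, map_sub, h4, map_mul, h3, finSuccEquiv_X_zero, finSuccEquiv_X_succ, hΦ, hu]
  simp only [hcoef]
  rw [Finset.sum_range] at key
  have key2 := congrArg (coeff (Finsupp.equivFunOnFinite.symm fun c => (ν c : ℕ))) key
  rw [coeff_sum] at key2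
  simp only [← map_pow, coeff_C_mul] at key2
  rw [← map_mul, ← map_one C, ← map_sub, ← map_mul, coeff_C_mul] at key2
  rw [mul_left_comm, ← key2, mul_sum]
  refine sum_congr rfl fun m _ => by ring

lemma masterSum_mul {S : Type*} [CommRing S] {N M : ℕ} (t κ : S) (x : Fin N → S)
    (hx : ∀ c, x c ^ M = 0) :
    masterSum M t x
        (fun c d => κ + if d < c then t else if c < d then 1 else 1 + t) *
      ((1 + κ) * ∏ c, (1 - x c) - (t + κ) * ∏ c, (1 - t * x c)) =
    (1 - t) * ∏ c, (1 - t * x c) := by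
  induction N generalizing κ with
  | zero =>
    simp [masterSum]
    rw [MvPolynomial.coeff_one, if_pos (Subsingleton.elim _ _), one_mul]
  | succ N ih =>
    obtain ⟨E, hE⟩ : ∃ E, E * (1 - (κ + (1 + t)) * x 0) = 1 :=
      ⟨∑ m ∈ range M, ((κ + (1 + t)) * x 0) ^ m, by
        rw [mul_comm, mul_neg_geom_sum, mul_pow, hx, mul_zero, sub_zero]⟩
    rw [masterSum_succ t x _ (hx 0) (E := E) (by simpa using hE)]
    have hA : (fun c d : Fin N => (κ + if d.succ < c.succ then t else
          if c.succ < d.succ then 1 else 1 + t) +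
        (κ + if (0 : Fin (N + 1)) < c.succ then t else if c.succ < 0 then 1 else 1 + t) *
          (E * x 0) *
        (κ + if d.succ < 0 then t else if 0 < d.succ then 1 else 1 + t)) =
        fun c d : Fin N => (κ + (κ + t) * (E * x 0) * (κ + 1)) +
          if d < c then t else if c < d then 1 else 1 + t := by
      funext c d
      simp only [Fin.succ_lt_succ_iff, Fin.succ_pos, Fin.not_lt_zero, if_true, if_false]
      ring
    rw [hA]
    have h := ih (κ + (κ + t) * (E * x 0) * (κ + 1)) (fun c => x c.succ) (fun c => hx _)
    have e1 : 1 + (κ + (κ + t) * (E * x 0) * (κ + 1)) = (1 + κ) * E * (1 - x 0) := by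
      linear_combination (-(1 + κ)) * hE
    have e2 : t + (κ + (κ + t) * (E * x 0) * (κ + 1)) = (t + κ) * E * (1 - t * x 0) := by
      linear_combination (-(t + κ)) * hE
    rw [e1, e2] at h
    simp only [Fin.prod_univ_succ]
    linear_combination (1 - t * x 0) * h

end Elimination

section Words

/-- The exponent vector counting the occurrences of each letter in the word `s`. -/
noncomputable def letterCount {n N : ℕ} (s : Fin n → Fin N) : Fin N →₀ ℕ :=
  ∑ k, Finsupp.single (s k) 1

lemma letterCount_apply {n N : ℕ} (s : Fin n → Fin N) (c : Fin N) :
    letterCount s c = (univ.filter fun k => s k = c).card := by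
  rw [letterCount, Finsupp.finsetSum_apply, card_filter]
  simp only [Finsupp.single_apply]

/-- The position `k` is the first one carrying its letter in `s`. -/
def IsFirstOccurrence {n N : ℕ} (s : Fin n → Fin N) (k : Fin n) : Prop := ∀ j < k, s j ≠ s k

open Classical in
lemma prod_headPow_letterCount {P : Type*} [CommRing P] {n N : ℕ} (s : Fin n → Fin N)
    (a b : Fin N → P) :
    ∏ c, headPow (a c) (b c) (letterCount s c) =
      ∏ k, if IsFirstOccurrence s k then a (s k) else b (s k) := by
  rw [← prod_fiberwise univ s]
  refine prod_congr rfl fun c _ => ?_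
  rw [letterCount_apply]
  obtain h | h := (univ.filter fun k => s k = c).eq_empty_or_nonempty
  · rw [h]; simp [headPow]
  · set F := univ.filter fun k => s k = c with hF
    have hmem : ∀ {k}, k ∈ F ↔ s k = c := by simp [hF]
    have h0 := F.min'_mem h
    rw [← mul_prod_erase F _ h0, if_pos, hmem.1 h0]
    · rw [prod_congr rfl (g := fun _ => b c), prod_const, card_erase_of_mem h0]
      · obtain ⟨m, hm⟩ := Nat.exists_eq_succ_of_ne_zero (card_pos.2 h).ne'
        rw [hm]; rfl
      · intro k hk
        obtain ⟨hk1, hk2⟩ := mem_erase.1 hk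
        rw [if_neg, hmem.1 hk2]
        unfold IsFirstOccurrence
        push Not
        exact ⟨_, lt_of_le_of_ne (F.min'_le k hk2) (Ne.symm hk1),
          (hmem.1 h0).trans (hmem.1 hk2).symm⟩
    · intro j hj he
      exact absurd (F.min'_le j (hmem.2 (he.trans (hmem.1 h0)))) (not_le.2 hj)

open MvPolynomial in
lemma coeff_prod_linear {S ι : Type*} [CommRing S] [Fintype ι] {n N : ℕ} (l : ι → Fin N)
    (v : Fin n → ι → S) (μ : Fin N →₀ ℕ) :
    coeff μ (∏ k, ∑ p, C (v k p) * X (l p)) =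
      ∑ f : Fin n → ι, if letterCount (fun k => l (f k)) = μ then ∏ k, v k (f k) else 0 := by
  classical
  rw [prod_univ_sum, Fintype.piFinset_univ, coeff_sum]
  refine sum_congr rfl fun f _ => ?_
  have h : ∏ k, (C (v k (f k)) * X (l (f k)) : MvPolynomial (Fin N) S) =
      monomial (letterCount fun k => l (f k)) (∏ k, v k (f k)) := by
    rw [letterCount, monomial_sum_index]
    rw [prod_mul_distrib, map_prod]
    rfl
  rw [h, coeff_monomial]

lemma exists_perm_of_letterCount_eq {n N : ℕ} {s w : Fin n → Fin N}
    (h : letterCount w = letterCount s) : ∃ τ : Equiv.Perm (Fin n), w = s ∘ τ := by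
  have hc : ∀ c, Fintype.card {k // w k = c} = Fintype.card {k // s k = c} := by
    intro c
    have := DFunLike.congr_fun h c
    rw [letterCount_apply, letterCount_apply] at this
    rwa [Fintype.card_subtype, Fintype.card_subtype]
  refine ⟨(Equiv.sigmaFiberEquiv w).symm.trans ((Equiv.sigmaCongrRight fun c =>
    Fintype.equivOfCardEq (hc c)).trans (Equiv.sigmaFiberEquiv s)), ?_⟩
  funext k
  exact (Fintype.equivOfCardEq (hc (w k)) ⟨k, rfl⟩).2.symm

lemma letterCount_comp_perm {n N : ℕ} (s : Fin n → Fin N) (τ : Equiv.Perm (Fin n)) :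
    letterCount (s ∘ τ) = letterCount s :=
  Equiv.sum_comp τ fun k => Finsupp.single (s k) 1

lemma eq_of_monotone_of_letterCount_eq {n N : ℕ} {s w : Fin n → Fin N} (hs : Monotone s)
    (hw : Monotone w) (h : letterCount w = letterCount s) : w = s := by
  obtain ⟨τ, rfl⟩ := exists_perm_of_letterCount_eq h
  exact Tuple.unique_monotone (τ := Equiv.refl _) hw hs

lemma exists_monotone_letterCount {n N : ℕ} (ν : Fin N →₀ ℕ) (h : ∑ c, ν c = n) :
    ∃ s : Fin n → Fin N, Monotone s ∧ letterCount s = ν := by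
  obtain ⟨w, hw⟩ : ∃ w : Fin n → Fin N, letterCount w = ν := by
    have e : Fin n ≃ Σ c : Fin N, Fin (ν c) :=
      Fintype.equivOfCardEq (by simp [h])
    refine ⟨fun k => (e k).1, ?_⟩
    ext c
    rw [letterCount, e.sum_comp (fun p => Finsupp.single p.1 1), Fintype.sum_sigma]
    simp
  exact ⟨w ∘ Tuple.sort w, Tuple.monotone_sort w, by rw [letterCount_comp_perm, hw]⟩

/-- The key by which the positions of `σ` are compared when excedance values are barred. -/
def barKey {n N : ℕ} (s : Fin n → Fin N) (σ : Equiv.Perm (Fin n)) (i : Fin n) : Fin N ×ₗ Bool :=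
  toLex (s i, decide (σ i ≤ i))

/-- `s` is weakly increasing, with strict steps at the barred descents of `σ`. -/
def Compatible {n N : ℕ} (s : Fin n → Fin N) (σ : Equiv.Perm (Fin n)) : Prop :=
  Monotone (barKey s σ) ∧ ∀ i j, i < j → barKey s σ i = barKey s σ j → σ i < σ j

/-- The barred letter `p` may stand at position `k` of a word whose sorted rearrangement is `s`. -/
def Allowed {n N : ℕ} (s : Fin n → Fin N) (k : Fin n) (p : Fin N ×ₗ Bool) : Prop :=
  ((ofLex p).1 < s k → (ofLex p).2 = false) ∧ (s k < (ofLex p).1 → (ofLex p).2 = true) ∧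
    (IsFirstOccurrence s k → (ofLex p).1 = s k → (ofLex p).2 = true)

lemma barKey_symm_allowed {n N : ℕ} {s : Fin n → Fin N} (hs : Monotone s)
    (σ : Equiv.Perm (Fin n)) (k : Fin n) : Allowed s k (barKey s σ (σ.symm k)) := by
  simp only [Allowed, barKey, ofLex_toLex, Equiv.apply_symm_apply, decide_eq_false_iff_not, not_le,
    decide_eq_true_eq]
  refine ⟨fun h => hs.reflect_lt h, fun h => (hs.reflect_lt h).le, fun h1 h2 => ?_⟩
  by_contra! h
  exact h1 _ h h2

lemma bar_iff_of_allowed {n N : ℕ} {s : Fin n → Fin N} (hs : Monotone s)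
    {f : Fin n → Fin N ×ₗ Bool} (hf : ∀ k, Allowed s k (f k)) {σ : Equiv.Perm (Fin n)}
    (hfs : ∀ i, (ofLex (f (σ i))).1 = s i) (hm : Monotone (f ∘ σ))
    (hst : ∀ i j, i < j → f (σ i) = f (σ j) → σ i < σ j) (i : Fin n) :
    (ofLex (f (σ i))).2 = decide (σ i ≤ i) := by
  have bool_le : ∀ {i j}, i ≤ j → s i = s j → (ofLex (f (σ i))).2 ≤ (ofLex (f (σ j))).2 := by
    intro i j hij he
    have := hm hij
    rw [Function.comp, Function.comp, Prod.Lex.le_iff, hfs, hfs] at this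
    rcases this with h | h
    · exact absurd he h.ne
    · exact h.2
  have key : ∀ {i j}, s i = s j → (ofLex (f (σ i))).2 = (ofLex (f (σ j))).2 → f (σ i) = f (σ j) :=
    fun {i j} h1 h2 => ofLex_inj.1 (Prod.ext (by rw [hfs, hfs, h1]) h2)
  have barred : ∀ m : ℕ, ∀ i : Fin n, (i : ℕ) = m → σ i ≤ i → (ofLex (f (σ i))).2 = true := by
    intro m
    induction m with
    | zero =>
      intro i hi hle
      by_contra hb
      have h0 : σ i = i := by ext; rw [Fin.le_def] at hle; omega
      refine hb ((hf (σ i)).2.2 (fun j hj => ?_) (by rw [hfs, h0]))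
      rw [Fin.lt_def] at hj; rw [Fin.le_def] at hle; omega
    | succ m ih =>
      intro i hi hle
      by_contra hb
      have h1 : ¬ s (σ i) < s i := fun h => hb ((hf (σ i)).2.1 (by rwa [hfs]))
      have h2 : s (σ i) = s i := le_antisymm (hs hle) (not_lt.1 h1)
      have h3 : ∃ j < σ i, s j = s (σ i) := by
        by_contra! h
        exact hb ((hf (σ i)).2.2 h (by rw [hfs, h2]))
      obtain ⟨j, hj, hsj⟩ := h3
      let i' : Fin n := ⟨m, by omega⟩
      have hi' : i' < i := by rw [Fin.lt_def]; simp [i']; omega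
      have hji' : j ≤ i' := by
        rw [Fin.le_def] at *; rw [Fin.lt_def] at hj; simp [i']; omega
      have hsi : s i' = s i := le_antisymm (hs hi'.le) (by rw [← h2, ← hsj]; exact hs hji')
      have hb' : (ofLex (f (σ i'))).2 = false := by
        have := bool_le hi'.le hsi
        rw [Bool.eq_false_iff.2 hb] at this
        exact Bool.eq_false_of_le_false this
      have hlt := hst i' i hi' (key hsi (by rw [hb', Bool.eq_false_iff.2 hb]))
      have := ih i' rfl (by rw [Fin.le_def] at *; rw [Fin.lt_def] at hlt; simp [i'] at *; omega)
      rw [hb'] at this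
      exact absurd this (by simp)
  have unbarred : ∀ m : ℕ, ∀ i : Fin n, (i : ℕ) + m = n → i < σ i →
      (ofLex (f (σ i))).2 = false := by
    intro m
    induction m with
    | zero => intro i hi; omega
    | succ m ih =>
      intro i hi hlt
      by_contra hb
      rw [Bool.not_eq_false] at hb
      have h1 : ¬ s i < s (σ i) := fun h => by
        have := (hf (σ i)).1 (by rwa [hfs])
        rw [hb] at this
        exact absurd this (by simp)
      have h2 : s (σ i) = s i := le_antisymm (not_lt.1 h1) (hs hlt.le)
      let i' : Fin n := ⟨i + 1, by rw [Fin.lt_def] at hlt; omega⟩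
      have hi' : i < i' := by rw [Fin.lt_def]; simp [i']
      have hi2 : i' ≤ σ i := by rw [Fin.le_def]; rw [Fin.lt_def] at hlt; simpa [i'] using hlt
      have hsi : s i = s i' := le_antisymm (hs hi'.le) (by rw [← h2]; exact hs hi2)
      have hb' : (ofLex (f (σ i'))).2 = true := by
        have := bool_le hi'.le hsi
        rw [hb] at this
        exact Bool.eq_true_of_true_le this
      have hlt' := hst i i' hi' (key hsi (by rw [hb', hb]))
      have := ih i' (by simp [i']; omega) (lt_of_le_of_lt hi2 hlt')
      rw [hb'] at this
      exact absurd this (by simp)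
  by_cases h : σ i ≤ i
  · rw [barred _ i rfl h]; simp [h]
  · rw [unbarred (n - i) i (by omega) (not_le.1 h)]; simp [h]

open Classical in
lemma sum_allowed_eq_sum_compatible {S : Type*} [CommRing S] {n N : ℕ} (t : S)
    {s : Fin n → Fin N} (hs : Monotone s) :
    (∑ f : Fin n → Fin N ×ₗ Bool,
      if letterCount (fun k => (ofLex (f k)).1) = letterCount s then
        ∏ k, (if Allowed s k (f k) then (if (ofLex (f k)).2 then 1 else t) else 0) else 0) =
    ∑ σ : Equiv.Perm (Fin n),
      if Compatible s σ then t ^ (univ.filter fun i => i < σ i).card else 0 := by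
  simp only [prod_ite_zero, mem_univ, true_imp_iff, ← ite_and]
  rw [← sum_filter, ← sum_filter]
  symm
  refine sum_bij' (fun σ _ k => barKey s σ (σ.symm k)) (fun f _ => Tuple.sort f) ?_ ?_ ?_ ?_ ?_
  · intro σ hσ
    refine mem_filter.2 ⟨mem_univ _, ?_, barKey_symm_allowed hs σ⟩
    exact letterCount_comp_perm s σ.symm
  · intro f hf
    obtain ⟨-, hc, ha⟩ := mem_filter.1 hf
    have hm := Tuple.monotone_sort f
    have hst := (Tuple.eq_sort_iff.1 (rfl : Tuple.sort f = Tuple.sort f)).2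
    have hfs : (fun k => (ofLex (f k)).1) ∘ Tuple.sort f = s := by
      refine eq_of_monotone_of_letterCount_eq hs (fun i j hij => ?_)
        ((letterCount_comp_perm _ _).trans hc)
      exact Prod.Lex.monotone_fst _ _ (hm hij)
    have hb := bar_iff_of_allowed hs ha (fun i => congrFun hfs i) hm hst
    have hk : barKey s (Tuple.sort f) = f ∘ Tuple.sort f := by
      funext i
      rw [barKey, ← hb, ← congrFun hfs i]
      rfl
    refine mem_filter.2 ⟨mem_univ _, ?_, ?_⟩
    · rw [hk]; exact hm
    · rw [hk]; exact hst
  · intro σ hσ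
    obtain ⟨-, h1, h2⟩ := mem_filter.1 hσ
    symm
    rw [Tuple.eq_sort_iff]
    have : (fun k => barKey s σ (σ.symm k)) ∘ σ = barKey s σ := by
      funext i; simp
    refine ⟨by rw [this]; exact h1, fun i j hij he => h2 i j hij (by simpa using he)⟩
  · intro f hf
    obtain ⟨-, hc, ha⟩ := mem_filter.1 hf
    have hm := Tuple.monotone_sort f
    have hst := (Tuple.eq_sort_iff.1 (rfl : Tuple.sort f = Tuple.sort f)).2
    have hfs : (fun k => (ofLex (f k)).1) ∘ Tuple.sort f = s := by
      refine eq_of_monotone_of_letterCount_eq hs (fun i j hij => ?_)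
        ((letterCount_comp_perm _ _).trans hc)
      exact Prod.Lex.monotone_fst _ _ (hm hij)
    have hb := bar_iff_of_allowed hs ha (fun i => congrFun hfs i) hm hst
    funext k
    have h1 := hb ((Tuple.sort f).symm k)
    have h2 := congrFun hfs ((Tuple.sort f).symm k)
    simp only [Function.comp, Equiv.apply_symm_apply] at h1 h2
    simp only [barKey, Equiv.apply_symm_apply]
    rw [← h1, ← h2]
    rfl
  · intro σ hσ
    rw [← Equiv.prod_comp σ]
    simp only [barKey, Equiv.symm_apply_apply, ofLex_toLex, decide_eq_true_eq]
    simp only [← not_lt, ite_not]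
    rw [prod_ite, prod_const, prod_const_one, mul_one]

open MvPolynomial Classical in
lemma coeff_prod_headPow_eq_sum_compatible {S : Type*} [CommRing S] {n N : ℕ} (t : S)
    {s : Fin n → Fin N} (hs : Monotone s) {A : Fin N → Fin N → S}
    (hA : A = fun c d => if d < c then t else if c < d then 1 else 1 + t) :
    coeff (letterCount s) (∏ c, headPow (∑ d, C (A c d) * X d - C t * X c)
      (∑ d, C (A c d) * X d) (letterCount s c)) =
    ∑ σ : Equiv.Perm (Fin n),
      if Compatible s σ then t ^ (univ.filter fun i => i < σ i).card else 0 := by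
  rw [prod_headPow_letterCount, ← sum_allowed_eq_sum_compatible t hs,
    ← coeff_prod_linear (fun p : Fin N ×ₗ Bool => (ofLex p).1)
      (fun k p => if Allowed s k p then (if (ofLex p).2 then 1 else t) else 0)]
  congr 1
  refine prod_congr rfl fun k _ => ?_
  have h1 : (C t * X (s k) : MvPolynomial (Fin N) S) =
      ∑ d, C (if d = s k then t else 0) * X d := by
    rw [sum_eq_single (s k)]
    · simp
    · intro d _ hd; simp [hd]
    · simp
  have h2 : (if IsFirstOccurrence s k then ∑ d, C (A (s k) d) * X d - C t * X (s k)
      else ∑ d, C (A (s k) d) * X d : MvPolynomial (Fin N) S) =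
      ∑ d, C (A (s k) d - if IsFirstOccurrence s k ∧ d = s k then t else 0) * X d := by
    split_ifs with h
    · rw [h1, ← sum_sub_distrib]
      refine sum_congr rfl fun d _ => ?_
      simp only [h, true_and, map_sub, sub_mul]
    · simp [h]
  rw [h2, ← (toLex (α := Fin N × Bool)).sum_comp, Fintype.sum_prod_type]
  refine sum_congr rfl fun d _ => ?_
  simp only [ofLex_toLex, ← sum_mul, ← map_sum, Fintype.sum_bool, Allowed, hA]
  congr 2
  rcases lt_trichotomy d (s k) with h | h | h
  · simp [h, h.ne, h.not_gt]
  · subst h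
    by_cases hh : IsFirstOccurrence s k <;> simp [hh]
  · simp [h, h.ne', h.not_gt]

end Words

section BarredDescents

open Classical in
lemma masterSum_eq_sum_words {S : Type*} [CommRing S] {N M L : ℕ} (t : S) (x : Fin N → S)
    (hx : ∀ c, x c ^ M = 0) (hL : ∀ ν : Fin N → Fin M, ∑ c, (ν c : ℕ) < L)
    {A : Fin N → Fin N → S}
    (hA : A = fun c d => if d < c then t else if c < d then 1 else 1 + t) :
    masterSum M t x A = ∑ n ∈ range L, ∑ σ : Equiv.Perm (Fin n),
      t ^ (univ.filter fun i => i < σ i).card *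
        ∑ s : Fin n → Fin N, if Compatible s σ then ∏ k, x (s k) else 0 := by
  rw [masterSum, ← sum_fiberwise_of_maps_to (t := range L)
    (g := fun ν : Fin N → Fin M => ∑ c, (ν c : ℕ)) (fun ν _ => mem_range.2 (hL ν))]
  refine sum_congr rfl fun n _ => ?_
  have hmono : ∀ (s : Fin n → Fin N) σ, Compatible s σ → Monotone s := fun s σ h i j hij =>
    Prod.Lex.monotone_fst _ _ (h.1 hij)
  have hprod : ∀ s : Fin n → Fin N, ∏ k, x (s k) = ∏ c, x c ^ letterCount s c := by
    intro s
    rw [← prod_fiberwise univ s]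
    refine prod_congr rfl fun c _ => ?_
    rw [letterCount_apply, ← prod_const]
    exact prod_congr rfl fun k hk => by rw [(mem_filter.1 hk).2]
  have hswap : (∑ σ : Equiv.Perm (Fin n), t ^ (univ.filter fun i => i < σ i).card *
        ∑ s : Fin n → Fin N, if Compatible s σ then ∏ k, x (s k) else 0) =
      ∑ s ∈ univ.filter fun s : Fin n → Fin N => Monotone s, (∏ c, x c ^ letterCount s c) *
        ∑ σ : Equiv.Perm (Fin n),
          if Compatible s σ then t ^ (univ.filter fun i => i < σ i).card else 0 := by
    simp only [mul_sum]
    rw [sum_comm, sum_filter]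
    refine sum_congr rfl fun s _ => ?_
    split_ifs with hs
    · refine sum_congr rfl fun σ _ => ?_
      rw [hprod]
      split_ifs <;> ring
    · refine sum_eq_zero fun σ _ => ?_
      rw [if_neg fun h => hs (hmono s σ h), mul_zero]
  rw [hswap]
  have hex : ∀ ν : Fin N → Fin M, ∑ c, (ν c : ℕ) = n → ∃ s : Fin n → Fin N, Monotone s ∧
      letterCount s = Finsupp.equivFunOnFinite.symm fun c => (ν c : ℕ) :=
    fun ν h => exists_monotone_letterCount _ (by simpa using h)
  have hterm : ∀ (ν : Fin N → Fin M) (s : Fin n → Fin N), Monotone s →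
      letterCount s = (Finsupp.equivFunOnFinite.symm fun c => (ν c : ℕ)) →
      (∏ c, x c ^ (ν c : ℕ)) * MvPolynomial.coeff
          (Finsupp.equivFunOnFinite.symm fun c => (ν c : ℕ))
          (∏ c, headPow (∑ d, MvPolynomial.C (A c d) * MvPolynomial.X d -
              MvPolynomial.C t * MvPolynomial.X c)
            (∑ d, MvPolynomial.C (A c d) * MvPolynomial.X d) (ν c)) =
        (∏ c, x c ^ letterCount s c) * ∑ σ : Equiv.Perm (Fin n),
          if Compatible s σ then t ^ (univ.filter fun i => i < σ i).card else 0 := by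
    intro ν s hs h
    rw [← coeff_prod_headPow_eq_sum_compatible t hs hA, h]
    rfl
  refine sum_bij_ne_zero (fun ν hν _ => (hex ν (mem_filter.1 hν).2).choose) ?_ ?_ ?_ ?_
  · intro ν hν _
    exact mem_filter.2 ⟨mem_univ _, (hex ν (mem_filter.1 hν).2).choose_spec.1⟩
  · intro ν hν _ ν' hν' _ h
    have h1 := (hex ν (mem_filter.1 hν).2).choose_spec.2
    rw [h, (hex ν' (mem_filter.1 hν').2).choose_spec.2] at h1
    funext c
    exact Fin.ext (DFunLike.congr_fun h1 c).symm
  · intro s hs hne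
    have hlt : ∀ c, letterCount s c < M := by
      intro c
      by_contra! h
      refine hne ?_
      rw [prod_eq_zero (mem_univ c) (by rw [← Nat.sub_add_cancel h, pow_add, hx, mul_zero]),
        zero_mul]
    let ν : Fin N → Fin M := fun c => ⟨letterCount s c, hlt c⟩
    have hsν : letterCount s = Finsupp.equivFunOnFinite.symm fun c => (ν c : ℕ) := by
      ext c; rfl
    have hν : ∑ c, (ν c : ℕ) = n := by
      simp only [ν, letterCount_apply]
      rw [← card_eq_sum_card_fiberwise (fun _ _ => mem_univ _), card_univ, Fintype.card_fin]
    refine ⟨ν, mem_filter.2 ⟨mem_univ _, hν⟩, ?_, ?_⟩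
    · rwa [hterm ν s (mem_filter.1 hs).2 hsν]
    · exact eq_of_monotone_of_letterCount_eq (mem_filter.1 hs).2 (hex ν hν).choose_spec.1
        ((hex ν hν).choose_spec.2.trans hsν.symm)
  · intro ν hν _
    have h := (mem_filter.1 hν).2
    exact hterm ν _ (hex ν h).choose_spec.1 (hex ν h).choose_spec.2

/-- The descent of `σ` at the position `i` when excedance values are barred and barred values
precede the others. -/
def BarDescent {n : ℕ} (σ : Equiv.Perm (Fin n)) (i : ℕ) : Prop :=
  ∃ h : i + 1 < n, ((σ ⟨i, by omega⟩ : ℕ) ≤ i ∧ i + 1 < (σ ⟨i + 1, h⟩ : ℕ)) ∨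
    (((σ ⟨i, by omega⟩ : ℕ) ≤ i ↔ (σ ⟨i + 1, h⟩ : ℕ) ≤ i + 1) ∧
      σ ⟨i + 1, h⟩ < σ ⟨i, by omega⟩)

open Classical in
/-- Consecutive entries of `s` are weakly increasing, and strictly so at the positions in `D`. -/
def StepsBy {n N : ℕ} (D : ℕ → Prop) (s : Fin n → Fin N) : Prop :=
  ∀ i (h : i + 1 < n), (s ⟨i, by omega⟩ : ℕ) + (if D i then 1 else 0) ≤ (s ⟨i + 1, h⟩ : ℕ)

open Classical in
lemma compatible_iff_stepsBy {n N : ℕ} (s : Fin n → Fin N) (σ : Equiv.Perm (Fin n)) :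
    Compatible s σ ↔ StepsBy (BarDescent σ) s := by
  have h1 : Compatible s σ ↔ StrictMono fun i => toLex (barKey s σ i, σ i) := by
    constructor
    · intro h i j hij
      rw [Prod.Lex.toLex_lt_toLex]
      obtain he | hl := (h.1 hij.le).eq_or_lt
      exacts [Or.inr ⟨he, h.2 i j hij he⟩, Or.inl hl]
    · intro h
      refine ⟨fun i j hij => Prod.Lex.monotone_fst _ _ (h.monotone hij), fun i j hij he => ?_⟩
      exact ((Prod.Lex.toLex_lt_toLex.1 (h hij)).resolve_left he.not_lt).2
  rw [h1]
  obtain _ | n := n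
  · exact ⟨fun _ i h => by omega, fun _ i => i.elim0⟩
  rw [Fin.strictMono_iff_lt_succ]
  have key : ∀ i (hi : i + 1 < n + 1),
      (toLex (barKey s σ ⟨i, by omega⟩, σ ⟨i, by omega⟩) <
        toLex (barKey s σ ⟨i + 1, hi⟩, σ ⟨i + 1, hi⟩) ↔
      (s ⟨i, by omega⟩ : ℕ) + (if BarDescent σ i then 1 else 0) ≤ (s ⟨i + 1, hi⟩ : ℕ)) := by
    intro i hi
    have hne : (σ ⟨i, by omega⟩ : ℕ) ≠ σ ⟨i + 1, hi⟩ := by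
      simp [← Fin.ext_iff]
    have hbd : BarDescent σ i ↔ (((σ ⟨i, by omega⟩ : ℕ) ≤ i ∧ i + 1 < (σ ⟨i + 1, hi⟩ : ℕ)) ∨
      (((σ ⟨i, by omega⟩ : ℕ) ≤ i ↔ (σ ⟨i + 1, hi⟩ : ℕ) ≤ i + 1) ∧
        σ ⟨i + 1, hi⟩ < σ ⟨i, by omega⟩)) := ⟨fun ⟨_, h⟩ => h, fun h => ⟨hi, h⟩⟩
    rw [Fin.lt_def] at hbd
    simp only [Prod.Lex.toLex_lt_toLex, barKey, toLex_inj, Prod.mk.injEq, Fin.le_def, Fin.lt_def,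
      Fin.ext_iff, hbd]
    by_cases h1 : (σ ⟨i, by omega⟩ : ℕ) ≤ i <;> by_cases h2 : (σ ⟨i + 1, hi⟩ : ℕ) ≤ i + 1 <;>
      simp only [h1, h2, decide_true, decide_false, lt_irrefl, Bool.false_lt_true, and_true,
        and_false, or_false, false_or, or_self, iff_true, iff_false, true_and, false_and,
        not_lt.2, not_true,
        not_lt_of_gt Bool.false_lt_true, Bool.false_eq_true, Bool.true_eq_false] <;>
      split_ifs <;> first | contradiction | omega
  refine ⟨fun h i hi => (key i hi).1 (h ⟨i, by omega⟩), fun h i => ?_⟩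
  exact (key i (by omega)).2 (h i (by omega))

end BarredDescents

section Geometric

lemma sum_geometric_of_pow_eq_zero {R : Type*} [CommRing R] {N b : ℕ} {y : R} (hy : y ^ N = 0)
    (hb : 1 ≤ b) :
    (∑ j : Fin N, if (j : ℕ) + b ≤ N then y ^ (N - j) else 0) * (1 - y) = y ^ b := by
  have h : ∀ m ≤ N, (∑ j ∈ range m, if j + b ≤ N then y ^ (N - j) else 0) * (1 - y) =
      y ^ max b (N - m + 1) - y ^ max b (N + 1) := by
    intro m hm
    induction m with
    | zero => simp
    | succ m ih =>
      rw [sum_range_succ, add_mul, ih (by omega)]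
      split_ifs with hmb
      · rw [max_eq_right (by omega), max_eq_right (show b ≤ N - (m + 1) + 1 by omega),
          show N - m = N - (m + 1) + 1 by omega]
        ring
      · rw [max_eq_left (by omega), max_eq_left (show N - (m + 1) + 1 ≤ b by omega)]
        ring
  have h0 : y ^ max b (N + 1) = 0 := pow_eq_zero_of_le (by omega) hy
  rw [Fin.sum_univ_eq_sum_range (fun j => if j + b ≤ N then y ^ (N - j) else 0), h N le_rfl, h0,
    max_eq_left (by omega), sub_zero]

lemma StepsBy.monotone {n N : ℕ} {D : ℕ → Prop} {s : Fin n → Fin N} (h : StepsBy D s) :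
    Monotone s := by
  obtain _ | n := n
  · exact fun i => i.elim0
  · refine Fin.monotone_iff_le_succ.2 fun i => ?_
    have := h i (by omega)
    exact Fin.le_def.2 ((Nat.le_add_right _ _).trans this)

open Classical in
lemma stepsBy_snoc_iff {n N b : ℕ} {D : ℕ → Prop} {s : Fin n → Fin N} {j : Fin N} :
    (StepsBy D (Fin.snoc s j : Fin (n + 1) → Fin N) ∧
        ∀ i, ((Fin.snoc s j : Fin (n + 1) → Fin N) i : ℕ) + b ≤ N) ↔
      (j : ℕ) + b ≤ N ∧ StepsBy D s ∧
        ∀ i, (s i : ℕ) + (N - j + if D (n - 1) then 1 else 0) ≤ N := by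
  have hs : ∀ i (h : i < n), (Fin.snoc s j : Fin (n + 1) → Fin N) ⟨i, by omega⟩ = s ⟨i, h⟩ :=
    fun i h => Fin.snoc_castSucc (α := fun _ => Fin N) j s ⟨i, h⟩
  have hl : (Fin.snoc s j : Fin (n + 1) → Fin N) ⟨n, by omega⟩ = j :=
    Fin.snoc_last (α := fun _ => Fin N) j s
  have hj := j.2
  constructor
  · rintro ⟨h1, h2⟩
    have h3 : StepsBy D s := fun i h => by
      have := h1 i (by omega)
      rwa [hs i (by omega), hs (i + 1) h] at this
    refine ⟨by simpa only [hl] using h2 ⟨n, by omega⟩, h3, fun i => ?_⟩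
    obtain _ | n := n
    · exact i.elim0
    have h4 := h1 n (by omega)
    rw [hs n (by omega), hl] at h4
    have h5 : (s i : ℕ) ≤ s ⟨n, by omega⟩ :=
      Fin.le_def.1 (h3.monotone (Fin.le_def.2 (by have := i.2; simp only; omega)))
    rw [Nat.add_sub_cancel]
    omega
  · rintro ⟨h1, h2, h3⟩
    refine ⟨fun i h => ?_, fun i => ?_⟩
    · obtain h' | h' := Nat.lt_or_ge (i + 1) n
      · rw [hs i (by omega), hs (i + 1) h']
        exact h2 i h'
      · obtain rfl : i + 1 = n := by omega
        rw [hs i (by omega), hl]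
        have := h3 ⟨i, by omega⟩
        rw [Nat.add_sub_cancel] at this
        omega
    · obtain ⟨i, hi⟩ := i
      obtain h' | h' := Nat.lt_or_ge i n
      · rw [hs i h']
        have := h3 ⟨i, h'⟩
        omega
      · obtain rfl : i = n := by omega
        rwa [hl]

open Classical in
lemma sum_stepsBy {R : Type*} [CommRing R] {N : ℕ} {q : R} (hq : q ^ N = 0) (D : ℕ → Prop)
    (n : ℕ) {b : ℕ} (hb : 1 ≤ b) :
    (∑ s : Fin n → Fin N,
        if StepsBy D s ∧ ∀ i, (s i : ℕ) + b ≤ N then ∏ i, q ^ (N - s i) else 0) *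
      ∏ i ∈ range n, (1 - q ^ (i + 1)) =
    q ^ (n * b + ∑ i ∈ range (n - 1), if D i then i + 1 else 0) := by
  induction n generalizing b with
  | zero =>
    have h : ∀ s : Fin 0 → Fin N, StepsBy D s := fun s i h => by omega
    simp [h]
  | succ n ih =>
    set ε : ℕ := if D (n - 1) then 1 else 0 with hε
    have hsum : (∑ i ∈ range n, if D i then i + 1 else 0) =
        n * ε + ∑ i ∈ range (n - 1), if D i then i + 1 else 0 := by
      obtain _ | n := n
      · simp
      · rw [sum_range_succ, hε, Nat.add_sub_cancel, add_comm]
        split_ifs <;> simp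
    have hsplit : (∑ s : Fin (n + 1) → Fin N,
        if StepsBy D s ∧ ∀ i, (s i : ℕ) + b ≤ N then ∏ i, q ^ (N - s i) else 0) =
        ∑ j : Fin N, if (j : ℕ) + b ≤ N then q ^ (N - j) * ∑ s : Fin n → Fin N,
          if StepsBy D s ∧ ∀ i, (s i : ℕ) + (N - j + ε) ≤ N then ∏ i, q ^ (N - s i) else 0
          else 0 := by
      rw [← (Fin.snocEquiv fun _ => Fin N).sum_comp, Fintype.sum_prod_type]
      refine sum_congr rfl fun j _ => ?_
      have hprod : ∀ s : Fin n → Fin N, ∏ i, q ^ (N - (Fin.snoc s j : Fin (n + 1) → Fin N) i) =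
          (∏ i, q ^ (N - s i)) * q ^ (N - j) := fun s => by
        simp [Fin.prod_univ_castSucc]
      refine (sum_congr rfl fun s _ => if_congr stepsBy_snoc_iff (hprod s) rfl).trans ?_
      by_cases hj : (j : ℕ) + b ≤ N
      · rw [if_pos hj, mul_sum]
        refine sum_congr rfl fun s _ => ?_
        rw [mul_comm (q ^ (N - (j : ℕ))), ite_mul, zero_mul]
        exact if_congr (and_iff_right hj) rfl rfl
      · rw [if_neg hj]
        exact sum_eq_zero fun s _ => if_neg fun h => hj h.1
    rw [hsplit, prod_range_succ, Nat.add_sub_cancel, hsum, ← mul_assoc, sum_mul]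
    have hterm : ∀ j : Fin N, (if (j : ℕ) + b ≤ N then q ^ (N - j) * ∑ s : Fin n → Fin N,
          if StepsBy D s ∧ ∀ i, (s i : ℕ) + (N - j + ε) ≤ N then ∏ i, q ^ (N - s i) else 0
          else 0) * ∏ i ∈ range n, (1 - q ^ (i + 1)) =
        q ^ (n * ε + ∑ i ∈ range (n - 1), if D i then i + 1 else 0) *
          if (j : ℕ) + b ≤ N then (q ^ (n + 1)) ^ (N - j) else 0 := by
      intro j
      split_ifs
      · rw [mul_assoc, ih (by have := j.2; omega)]
        ring
      · simp
    rw [sum_congr rfl fun j _ => hterm j, ← mul_sum, mul_assoc,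
      sum_geometric_of_pow_eq_zero (by rw [← pow_mul, mul_comm, pow_mul, hq, zero_pow (by omega)])
        hb]
    ring

end Geometric

section MajorIndex

lemma pv_succ {n : ℕ} (σ : Equiv.Perm (Fin n)) {i : ℕ} (h : i < n) :
    pv σ (i + 1) = σ ⟨i, h⟩ + 1 := by
  rw [pv, dif_pos ⟨by omega, by omega⟩]
  rfl

lemma exc_eq_sum {n : ℕ} (σ : Equiv.Perm (Fin n)) :
    exc σ = ∑ i ∈ range (n - 1), if i + 1 < pv σ (i + 1) then 1 else 0 := by
  rw [exc, ExcSet, card_filter, ← Finset.Ico_add_one_right_eq_Icc, sum_Ico_eq_sum_range,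
    Nat.add_sub_cancel]
  exact sum_congr rfl fun i _ => by rw [add_comm 1 i]

lemma exc_eq_card {n : ℕ} (σ : Equiv.Perm (Fin n)) :
    exc σ = (univ.filter fun i => i < σ i).card := by
  have h : (univ.filter fun i => i < σ i).card =
      ∑ i ∈ range n, if i + 1 < pv σ (i + 1) then 1 else 0 := by
    rw [card_filter, ← Fin.sum_univ_eq_sum_range]
    refine sum_congr rfl fun i _ => ?_
    rw [pv_succ σ i.2]
    simp
  rw [h, exc_eq_sum]
  obtain _ | n := n
  · rfl
  · rw [sum_range_succ, Nat.add_sub_cancel, if_neg, add_zero]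
    have := (σ ⟨n, by omega⟩).2
    rw [pv_succ σ (by omega)]
    omega

open Classical in
lemma maj_eq_sum_barDescent_add_exc {n : ℕ} (σ : Equiv.Perm (Fin n)) :
    maj σ = (∑ i ∈ range (n - 1), if BarDescent σ i then i + 1 else 0) + exc σ := by
  have hmaj : maj σ = ∑ i ∈ range (n - 1), if pv σ (i + 2) < pv σ (i + 1) then i + 1 else 0 := by
    rw [maj, DesSet, sum_filter, ← Finset.Ico_add_one_right_eq_Icc, sum_Ico_eq_sum_range,
      Nat.add_sub_cancel]
    exact sum_congr rfl fun i _ => by rw [add_comm 1 i]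
  have key : ∀ m ≤ n - 1, (∑ i ∈ range m, if pv σ (i + 2) < pv σ (i + 1) then i + 1 else 0) +
      (if m + 1 < pv σ (m + 1) then m else 0) =
      (∑ i ∈ range m, if BarDescent σ i then i + 1 else 0) +
        ∑ i ∈ range m, if i + 1 < pv σ (i + 1) then 1 else 0 := by
    intro m hm
    induction m with
    | zero => simp
    | succ m ih =>
      have ih := ih (by omega)
      have hlt : m + 1 < n := by omega
      have hne : (σ ⟨m, by omega⟩ : ℕ) ≠ σ ⟨m + 1, hlt⟩ := by
        simp [← Fin.ext_iff]
      have hbd : BarDescent σ m ↔ (((σ ⟨m, by omega⟩ : ℕ) ≤ m ∧ m + 1 < (σ ⟨m + 1, hlt⟩ : ℕ)) ∨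
          (((σ ⟨m, by omega⟩ : ℕ) ≤ m ↔ (σ ⟨m + 1, hlt⟩ : ℕ) ≤ m + 1) ∧
            σ ⟨m + 1, hlt⟩ < σ ⟨m, by omega⟩)) := ⟨fun ⟨_, h⟩ => h, fun h => ⟨hlt, h⟩⟩
      rw [Fin.lt_def] at hbd
      have h2 := pv_succ σ hlt
      have h1 := pv_succ σ (show m < n by omega)
      simp only [sum_range_succ, add_assoc, hbd, h1, one_add_one_eq_two] at ih ⊢
      rw [add_assoc] at h2
      simp only [h2] at ih ⊢
      generalize (σ ⟨m + 1, hlt⟩ : ℕ) = b at *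
      generalize (σ ⟨m, _⟩ : ℕ) = a at *
      grind
  have h := key (n - 1) le_rfl
  have hlast : ¬ n - 1 + 1 < pv σ (n - 1 + 1) := by
    obtain _ | n := n
    · simp [pv]
    · have := (σ ⟨n, by omega⟩).2
      rw [pv_succ σ (by omega)]
      simp only [Nat.add_sub_cancel]
      omega
  rw [if_neg hlast, add_zero, ← hmaj, ← exc_eq_sum] at h
  exact h

end MajorIndex

section Gaussian

variable {R : Type*} [CommRing R]

/-- The product `(1 - q)(1 - q²)⋯(1 - qⁿ)`. -/
def qPoch (q : R) (n : ℕ) : R := ∏ i ∈ range n, (1 - q ^ (i + 1))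

lemma qPoch_succ (q : R) (n : ℕ) : qPoch q (n + 1) = qPoch q n * (1 - q ^ (n + 1)) :=
  prod_range_succ _ _

/-- The Gaussian binomial coefficient, defined by its Pascal recurrence. -/
def qChoose (q : R) : ℕ → ℕ → R
  | _, 0 => 1
  | 0, _ + 1 => 0
  | n + 1, k + 1 => qChoose q n k + q ^ (k + 1) * qChoose q n (k + 1)

lemma map_qChoose {R' : Type*} [CommRing R'] (f : R →+* R') (q : R) (n k : ℕ) :
    f (qChoose q n k) = qChoose (f q) n k := by
  induction n generalizing k with
  | zero => cases k <;> simp [qChoose]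
  | succ n ih => cases k <;> simp [qChoose, ih]

lemma qChoose_eq_zero (q : R) {n k : ℕ} (h : n < k) : qChoose q n k = 0 := by
  induction n generalizing k with
  | zero => obtain _ | k := k; exacts [absurd h (by omega), rfl]
  | succ n ih =>
    obtain _ | k := k
    · omega
    · rw [qChoose, ih (by omega), ih (by omega), mul_zero, add_zero]

lemma qChoose_self (q : R) (n : ℕ) : qChoose q n n = 1 := by
  induction n with
  | zero => rfl
  | succ n ih => rw [qChoose, ih, qChoose_eq_zero q (by omega), mul_zero, add_zero]

lemma qChoose_mul_qPoch (q : R) (m k : ℕ) :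
    qChoose q (m + k) m * (qPoch q m * qPoch q k) = qPoch q (m + k) := by
  induction hn : m + k generalizing m k with
  | zero =>
    obtain ⟨rfl, rfl⟩ : m = 0 ∧ k = 0 := by omega
    simp [qChoose, qPoch]
  | succ n ih =>
    obtain _ | m := m
    · simp [qChoose, qPoch, ← hn]
    obtain _ | k := k
    · rw [← hn, add_zero, qChoose_self]
      simp [qPoch]
    have h1 := ih m (k + 1) (by omega)
    have h2 := ih (m + 1) k (by omega)
    rw [qPoch_succ] at h1 h2
    obtain rfl : n = m + k + 1 := by omega
    rw [qChoose, qPoch_succ, qPoch_succ, qPoch_succ]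
    linear_combination (1 - q ^ (m + 1)) * h1 + q ^ (m + 1) * (1 - q ^ (k + 1)) * h2

lemma isUnit_qPoch {q : R} (hq : IsNilpotent q) (n : ℕ) : IsUnit (qPoch q n) := by
  induction n with
  | zero => simp [qPoch]
  | succ n ih =>
    rw [qPoch_succ]
    exact ih.mul (IsNilpotent.isUnit_one_sub (hq.pow_of_pos (Nat.succ_ne_zero n)))

open PowerSeries in
lemma mk_mul_prod_one_sub {q : R} {N : ℕ} (hq : q ^ N = 0) {u : ℕ → R}
    (hu : ∀ k, u k * qPoch q k = 1) (T : R) :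
    (PowerSeries.mk fun k => T ^ k * q ^ k * u k) *
      ∏ c : Fin N, (1 - C T * (C (q ^ (N - c : ℕ)) * X)) = 1 := by
  have hu' : ∀ k, u (k + 1) * (1 - q ^ (k + 1)) = u k := by
    intro k
    have h1 := hu (k + 1)
    rw [qPoch_succ] at h1
    linear_combination u k * h1 - u (k + 1) * (1 - q ^ (k + 1)) * hu k
  have hstep : ∀ j,
      (PowerSeries.mk fun k => T ^ k * (q ^ j) ^ k * u k) * (1 - C T * (C (q ^ j) * X)) =
      PowerSeries.mk fun k => T ^ k * (q ^ (j + 1)) ^ k * u k := by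
    intro j
    ext k
    rw [mul_sub, mul_one, map_sub, ← mul_assoc (C T), ← map_mul, mul_left_comm, coeff_C_mul]
    obtain _ | k := k
    · simp
    · rw [coeff_succ_mul_X, coeff_mk, coeff_mk, coeff_mk, ← hu' k]
      ring
  have hprod : ∀ m, (PowerSeries.mk fun k => T ^ k * q ^ k * u k) *
      ∏ j ∈ range m, (1 - C T * (C (q ^ (j + 1)) * X)) =
        PowerSeries.mk fun k => T ^ k * (q ^ (m + 1)) ^ k * u k := by
    intro m
    induction m with
    | zero => simp
    | succ m ih => rw [prod_range_succ, ← mul_assoc, ih, hstep]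
  have hrev : ∏ c : Fin N, (1 - C T * (C (q ^ (N - c : ℕ)) * X)) =
      ∏ j ∈ range N, (1 - C T * (C (q ^ (j + 1)) * X)) := by
    rw [← prod_range_reflect, Fin.prod_univ_eq_prod_range
      (fun c => (1 - C T * (C (q ^ (N - c)) * X) : PowerSeries R)) N]
    refine prod_congr rfl fun c hc => ?_
    rw [show N - 1 - c + 1 = N - c by have := mem_range.1 hc; omega]
  rw [hrev, hprod, pow_succ, hq, zero_mul]
  ext k
  obtain _ | k := k
  · have := hu 0
    simpa [qPoch] using this
  · simp [coeff_one]

end Gaussian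

section NilpotentBase

variable {R : Type*} [CommRing R]

open Classical in
/-- The Eulerian polynomial counting excedances by `T` and barred descent positions by `q`. -/
noncomputable def barEulerian (q T : R) (n : ℕ) : R :=
  ∑ σ : Equiv.Perm (Fin n), q ^ (∑ i ∈ range (n - 1), if BarDescent σ i then i + 1 else 0) *
    T ^ (univ.filter fun i => i < σ i).card

open Classical in
lemma sum_compatible_mul_qPoch {N : ℕ} {q : R} (hq : q ^ N = 0) (T : R) (n : ℕ) :
    (∑ σ : Equiv.Perm (Fin n), T ^ (univ.filter fun i => i < σ i).card *
      ∑ s : Fin n → Fin N, if Compatible s σ then ∏ k, q ^ (N - s k : ℕ) else 0) * qPoch q n =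
    q ^ n * barEulerian q T n := by
  rw [barEulerian, sum_mul, mul_sum]
  refine sum_congr rfl fun σ _ => ?_
  have h := sum_stepsBy hq (BarDescent σ) n le_rfl
  have hs : ∀ s : Fin n → Fin N, (StepsBy (BarDescent σ) s ∧ ∀ i, (s i : ℕ) + 1 ≤ N) ↔
      Compatible s σ := fun s => by
    rw [compatible_iff_stepsBy]
    exact and_iff_left fun i => (s i).2
  simp only [hs, mul_one] at h
  rw [mul_assoc, qPoch, h, pow_add]
  ring

open PowerSeries in
lemma barEulerian_recurrence {M : ℕ} {q : R} (hq : q ^ M = 0) (T : R) (n : ℕ) :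
    q ^ n * ∑ m ∈ range (n + 1), qChoose q n m * (T ^ (n - m) - T) * barEulerian q T m =
      q ^ n * (1 - T) := by
  classical
  choose u hu' using fun k => (isUnit_qPoch ⟨M, hq⟩ k).exists_left_inv
  have hu : ∀ k, u k * qPoch q k = 1 := hu'
  set x : Fin M → PowerSeries R := fun c => C (q ^ (M - c : ℕ)) * X with hx
  have hxM : ∀ c, x c ^ M = 0 := fun c => by
    rw [hx, mul_pow, ← map_pow, ← pow_mul, mul_comm _ M, pow_mul, hq,
      zero_pow (by have := c.2; omega), map_zero, zero_mul]
  set L := M * M + n + 1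
  have hL : ∀ ν : Fin M → Fin M, ∑ c, (ν c : ℕ) < L := fun ν => by
    have := sum_le_card_nsmul univ (fun c => (ν c : ℕ)) M fun c _ => (ν c).2.le
    simp only [card_univ, Fintype.card_fin, smul_eq_mul] at this
    omega
  set Q : ℕ → R := fun m => ∑ σ : Equiv.Perm (Fin m), T ^ (univ.filter fun i => i < σ i).card *
      ∑ s : Fin m → Fin M, if Compatible s σ then ∏ k, q ^ (M - s k : ℕ) else 0 with hQ
  set A : Fin M → Fin M → PowerSeries R :=
    fun c d => if d < c then C T else if c < d then 1 else 1 + C T with hA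
  have hG : masterSum M (C T) x A = ∑ m ∈ range L, C (Q m) * X ^ m := by
    rw [masterSum_eq_sum_words (C T) x hxM hL hA]
    refine sum_congr rfl fun m _ => ?_
    simp only [hQ, map_sum, sum_mul, map_mul, map_pow, mul_assoc, apply_ite (C (R := R)), map_prod,
      map_zero, ite_mul, zero_mul, hx, prod_mul_distrib, prod_const, card_univ, Fintype.card_fin]
  have hcoeff : ∀ k ≤ n, coeff k (masterSum M (C T) x A) = Q k := by
    intro k hk
    rw [hG, map_sum]
    simp only [coeff_C_mul_X_pow]
    rw [sum_ite_eq, if_pos (mem_range.2 (by omega))]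
  have hmaster := masterSum_mul (C T) 0 x hxM
  simp only [zero_add, add_zero, one_mul] at hmaster
  rw [← hA] at hmaster
  have h1 := mk_mul_prod_one_sub hq hu 1
  have hT := mk_mul_prod_one_sub hq hu T
  simp only [map_one, one_mul, one_pow] at h1
  set e := PowerSeries.mk fun k => q ^ k * u k
  set f := PowerSeries.mk fun k => T ^ k * q ^ k * u k
  set P := ∏ c, (1 - x c)
  set PT := ∏ c, (1 - C T * x c)
  have hseries : masterSum M (C T) x A * (f - C T * e) = C (1 - T) * e := by
    have h1 : e * P = 1 := h1
    have hT : f * PT = 1 := hT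
    rw [map_sub, map_one]
    linear_combination e * f * hmaster - masterSum M (C T) x A * f * h1 +
      C T * masterSum M (C T) x A * e * hT + (1 - C T) * e * hT
  have h := congrArg (fun φ => coeff n φ * qPoch q n) hseries
  simp only [coeff_C_mul, e, coeff_mk] at h
  rw [mul_assoc, mul_assoc, hu, mul_one, mul_comm (1 - T)] at h
  rw [← h, coeff_mul, sum_mul, mul_sum, Nat.sum_antidiagonal_eq_sum_range_succ_mk]
  refine sum_congr rfl fun m hm => ?_
  have hm' : m ≤ n := by have := mem_range.1 hm; omega
  rw [hcoeff m hm', map_sub, coeff_C_mul, coeff_mk, coeff_mk]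
  have hQm : Q m * qPoch q m = q ^ m * barEulerian q T m := sum_compatible_mul_qPoch hq T m
  have hch := qChoose_mul_qPoch q m (n - m)
  rw [Nat.add_sub_cancel' hm'] at hch
  have hun := hu (n - m)
  have hpow : q ^ n = q ^ m * q ^ (n - m) := by rw [← pow_add, Nat.add_sub_cancel' hm']
  rw [← hch, hpow]
  linear_combination (-(qChoose q n m * (T ^ (n - m) - T) * q ^ (n - m))) * hQm -
    Q m * qChoose q n m * qPoch q m * (T ^ (n - m) - T) * q ^ (n - m) * hun

end NilpotentBase

section PolynomialIdentity

lemma map_barEulerian {R R' : Type*} [CommRing R] [CommRing R'] (f : R →+* R') (q T : R) (n : ℕ) :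
    f (barEulerian q T n) = barEulerian (f q) (f T) n := by
  simp [barEulerian]

/-- The recurrence for a cancellable base that is adically separated: it may be checked modulo
every power of the base. -/
lemma barEulerian_recurrence_of_finiteMultiplicity {R : Type*} [CommRing R] [IsDomain R] {q : R}
    (hq : ∀ a : R, a ≠ 0 → FiniteMultiplicity q a) (hq0 : q ≠ 0) (T : R) (n : ℕ) :
    ∑ m ∈ range (n + 1), qChoose q n m * (T ^ (n - m) - T) * barEulerian q T m = 1 - T := by
  rw [← sub_eq_zero]
  set E := ∑ m ∈ range (n + 1), qChoose q n m * (T ^ (n - m) - T) * barEulerian q T m - (1 - T)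
    with hE
  by_contra hne
  obtain ⟨M, hM⟩ := hq (q ^ n * E) (mul_ne_zero (pow_ne_zero n hq0) hne)
  refine hM (Ideal.mem_span_singleton.1 (Ideal.Quotient.eq_zero_iff_mem.1 ?_))
  set π := Ideal.Quotient.mk (Ideal.span {q ^ (M + 1)})
  have hπ : π q ^ (M + 1) = 0 := by
    rw [← map_pow]
    exact Ideal.Quotient.eq_zero_iff_mem.2 (Ideal.mem_span_singleton_self _)
  have h := barEulerian_recurrence hπ (π T) n
  rw [hE]
  simp only [map_mul, map_sub, map_sum, map_pow, map_one, map_barEulerian, map_qChoose]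
  rw [mul_sub, h, sub_self]

lemma one_sub_qv_pow_ne_zero (i : ℕ) : 1 - qv ^ (i + 1) ≠ 0 := by
  intro h
  rw [qv, ← map_pow, ← map_one (algebraMap (MvPolynomial (Fin 2) ℤ) K), ← map_sub,
    map_eq_zero_iff _ (IsFractionRing.injective (MvPolynomial (Fin 2) ℤ) K)] at h
  have := congrArg (MvPolynomial.eval 0) h
  simp at this

lemma qPoch_qv_ne_zero (n : ℕ) : qPoch qv n ≠ 0 :=
  prod_ne_zero_iff.2 fun i _ => one_sub_qv_pow_ne_zero i

lemma one_sub_pow_mul_qFact (n : ℕ) : (1 - qv) ^ n * qFact qv n = qPoch qv n := by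
  rw [qFact, qPoch, ← card_range n, ← prod_const, card_range, ← prod_mul_distrib]
  refine prod_congr rfl fun i _ => ?_
  rw [qInt, mul_neg_geom_sum]

lemma qBinom_eq_qChoose {n m : ℕ} (h : m ≤ n) : qBinom n m = qChoose qv n m := by
  have hm := qPoch_qv_ne_zero m
  have hk := qPoch_qv_ne_zero (n - m)
  have hch := qChoose_mul_qPoch qv m (n - m)
  rw [Nat.add_sub_cancel' h] at hch
  have hpow : (1 - qv) ^ n = (1 - qv) ^ m * (1 - qv) ^ (n - m) := by
    rw [← pow_add, Nat.add_sub_cancel' h]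
  rw [← one_sub_pow_mul_qFact] at hm hk
  rw [← one_sub_pow_mul_qFact, ← one_sub_pow_mul_qFact, ← one_sub_pow_mul_qFact, hpow] at hch
  rw [qBinom, div_eq_iff (mul_ne_zero (right_ne_zero_of_mul hm) (right_ne_zero_of_mul hk))]
  refine mul_left_cancel₀ (mul_ne_zero (left_ne_zero_of_mul hm) (left_ne_zero_of_mul hk)) ?_
  linear_combination -hch

lemma qEulerian_eq_barEulerian (n : ℕ) : qEulerian n = barEulerian qv (tv * qv) n := by
  classical
  refine sum_congr rfl fun σ _ => ?_
  rw [maj_eq_sum_barDescent_add_exc, ← exc_eq_card, mul_pow, pow_add]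
  ring

lemma X_finiteMultiplicity (a : MvPolynomial (Fin 2) ℤ) (ha : a ≠ 0) :
    FiniteMultiplicity (MvPolynomial.X 0) a :=
  .of_not_isUnit (MvPolynomial.X_prime).not_isUnit ha

end PolynomialIdentity

theorem q_exponential_generating_function_coefficientwise (n : ℕ) :
    ∑ m ∈ Finset.range (n + 1),
      qBinom n m * ((tv * qv) ^ (n - m) - tv * qv) * qEulerian m = 1 - tv * qv := by
  have h := congrArg (algebraMap (MvPolynomial (Fin 2) ℤ) K)
    (barEulerian_recurrence_of_finiteMultiplicity X_finiteMultiplicity (MvPolynomial.X_ne_zero 0)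
      (MvPolynomial.X 1 * MvPolynomial.X 0) n)
  simp only [map_mul, map_sub, map_sum, map_pow, map_one, map_barEulerian, map_qChoose] at h
  rw [← qv, ← tv] at h
  rw [← h]
  refine sum_congr rfl fun m hm => ?_
  rw [qBinom_eq_qChoose (by have := mem_range.1 hm; omega), qEulerian_eq_barEulerian]

end
end

section
/- For every permutation σ of [n]={1,…,n}, Σ_{i∈Exd(σ)} i = maj(σ) − exc(σ). -/
/-- The excedance-descent set `Exd(σ) ⊆ [n-1]`: the descent set of the word obtained
from σ by barring every excedance letter, with respect to the alphabet ordering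
`1̄ < 2̄ < ⋯ < n̄ < 1 < 2 < ⋯ < n`.  Explicitly, `i ∈ Exd(σ)` iff
(σ(i) ≤ i and σ(i+1) > i+1), or (σ(i) > i and σ(i+1) > i+1 and σ(i) > σ(i+1)),
or (σ(i) ≤ i and σ(i+1) ≤ i+1 and σ(i) > σ(i+1)). -/
def ExdSet {n : ℕ} (σ : Equiv.Perm (Fin n)) : Finset ℕ :=
  (Finset.Icc 1 (n - 1)).filter fun i =>
    (pv σ i ≤ i ∧ i + 1 < pv σ (i + 1)) ∨
    (i < pv σ i ∧ i + 1 < pv σ (i + 1) ∧ pv σ (i + 1) < pv σ i) ∨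
    (pv σ i ≤ i ∧ pv σ (i + 1) ≤ i + 1 ∧ pv σ (i + 1) < pv σ i)

/-- At consecutive positions of `[n]` the letters of `σ` differ. -/
lemma pv_ne_pv_succ {n i : ℕ} (σ : Equiv.Perm (Fin n)) (h1 : 1 ≤ i) (h2 : i + 1 ≤ n) :
    pv σ i ≠ pv σ (i + 1) := by
  intro h
  rw [pv, pv, dif_pos ⟨h1, by omega⟩, dif_pos ⟨by omega, h2⟩] at h
  have hfin := σ.injective (Fin.ext (Nat.succ_injective h))
  simp only [Fin.mk.injEq] at hfin
  omega

lemma pv_le {n i : ℕ} (σ : Equiv.Perm (Fin n)) (hi : i ≤ n) : pv σ i ≤ n := by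
  unfold pv
  split_ifs
  · exact (σ _).isLt
  · exact hi

/-- Summation by parts for the weight `i`. -/
lemma sum_Icc_mul_sub_succ (e : ℕ → ℤ) (m : ℕ) :
    ∑ i ∈ Finset.Icc 1 m, (i : ℤ) * (e (i + 1) - e i) =
      m * e (m + 1) - ∑ i ∈ Finset.Icc 1 m, e i := by
  induction m with
  | zero => simp
  | succ m ih =>
    rw [Finset.sum_Icc_succ_top (by omega), Finset.sum_Icc_succ_top (by omega), ih]
    push_cast
    ring

theorem sum_exd_eq_maj_sub_exc {n : ℕ} (σ : Equiv.Perm (Fin n)) :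
    (∑ i ∈ ExdSet σ, (i : ℤ)) = (maj σ : ℤ) - (exc σ : ℤ) := by
  have parts := sum_Icc_mul_sub_succ (fun i => if i < pv σ i then 1 else 0) (n - 1)
  have boundary : ((n - 1 : ℕ) : ℤ) * (if n - 1 + 1 < pv σ (n - 1 + 1) then 1 else 0) = 0 := by
    rcases n.eq_zero_or_pos with rfl | hn
    · simp
    · rw [Nat.sub_add_cancel hn, if_neg (pv_le σ le_rfl).not_gt, mul_zero]
  rw [boundary, zero_sub] at parts
  rw [maj, exc, ExdSet, DesSet, ExcSet, Finset.card_filter]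
  push_cast
  rw [sub_eq_add_neg, ← parts, Finset.sum_filter, Finset.sum_filter, ← Finset.sum_add_distrib]
  refine Finset.sum_congr rfl fun i hi => ?_
  rw [Finset.mem_Icc] at hi
  have hne := pv_ne_pv_succ σ hi.1 (by omega)
  split_ifs <;> omega
end
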